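/- Let $\Delta$ be a root system with base $\Sigma$ and let $I_1, I_2$ be subsets of bases of $\Delta$ with corresponding projections $\pi_1, \pi_2$ onto the quotients modulo their spans. There exists a surjection $\pi_{12} : \pi_1(\Delta) \to \pi_2(\Delta)$ with $\pi_2 = \pi_{12} \circ \pi_1$ if and only if there exist a base $\Sigma$ of $\Delta$ and subsets $I_1' \subset I_2' \subset \Sigma$ with $\langle I_1' \rangle = \langle I_1 \rangle$ and $\langle I_2' \rangle = \langle I_2 \rangle$. -/

import Mathlib

variable {V : Type*} [AddCommGroup V] [Module ℝ V]

def IsRootSystem (Δ : Set V) : Prop :=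
  Δ.Finite ∧ (0 : V) ∉ Δ ∧ (∀ α ∈ Δ, -α ∈ Δ) ∧
    ∀ α ∈ Δ, ∃ f : V →ₗ[ℝ] ℝ, f α = 2 ∧ (∀ β ∈ Δ, ∃ n : ℤ, f β = (n : ℝ)) ∧
      ∀ β ∈ Δ, β - f β • α ∈ Δ

def IsBase {W : Type*} [AddCommGroup W] [Module ℝ W] (Δ S : Set W) : Prop :=
  S ⊆ Δ ∧ LinearIndependent ℝ ((↑) : S → W) ∧
    ∀ β ∈ Δ, ∃ c : W →₀ ℤ, ↑c.support ⊆ S ∧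
      β = c.sum (fun v n => (n : ℝ) • v) ∧ ((∀ v, 0 ≤ c v) ∨ (∀ v, c v ≤ 0))

open Module Submodule in
/-- The root pairing that a root system `Δ` induces on its span. -/
theorem IsRootSystem.exists_rootPairing {Δ : Set V} (hΔ : IsRootSystem Δ) :
    ∃ P : RootPairing Δ ℝ (span ℝ Δ) (Dual ℝ (span ℝ Δ)),
      P.IsCrystallographic ∧ ∀ i, (P.root i : V) = i := by
  obtain ⟨hfin, -, -, hcoroot⟩ := hΔ
  have : Finite Δ := hfin
  have : FiniteDimensional ℝ (span ℝ Δ) := FiniteDimensional.span_of_finite ℝ hfin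
  choose f hf2 hfint hfrefl using hcoroot
  let root : Δ ↪ span ℝ Δ :=
    ⟨fun α ↦ ⟨α, subset_span α.2⟩, fun _ _ h ↦ by simpa [Subtype.ext_iff] using h⟩
  let g : Δ → Dual ℝ (span ℝ Δ) := fun α ↦ (f α α.2).domRestrict (span ℝ Δ)
  have hmaps (α : Δ) :
      Set.MapsTo (preReflection (root α) (g α)) (Set.range root) (Set.range root) := by
    rintro - ⟨β, rfl⟩
    exact ⟨⟨_, hfrefl α α.2 β β.2⟩, Subtype.ext rfl⟩
  have hself (α : Δ) : g α (root α) = 2 := hf2 α α.2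
  have : IsAddTorsionFree (span ℝ Δ) := .of_isTorsionFree ℝ _
  have hinj : Function.Injective g := fun α β h ↦ root.injective <|
    eq_of_mapsTo_reflection_of_mem (f := g α) (g := g β) (Set.finite_range root)
      (hself α) (hself β) (h ▸ hself α) (h ▸ hself β) (hmaps α) (hmaps β) ⟨β, rfl⟩
  have hspan : span ℝ (Set.range root) = ⊤ := by
    have : Set.range root = ((↑) : span ℝ Δ → V) ⁻¹' Δ := by
      ext x
      exact ⟨by rintro ⟨α, rfl⟩; exact α.2, fun hx ↦ ⟨⟨x, hx⟩, rfl⟩⟩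
    rw [this, span_span_coe_preimage]
  refine ⟨RootPairing.mk'' (Dual.eval ℝ _) root ⟨g, hinj⟩ hself hmaps hspan,
    ⟨fun α β ↦ ?_⟩, fun _ ↦ rfl⟩
  obtain ⟨n, hn⟩ := hfint β β.2 α α.2
  exact ⟨n, hn.symm⟩

theorem exists_finsupp_of_mem_closure {S : Set V} {x : V} (hx : x ∈ AddSubmonoid.closure S) :
    ∃ c : V →₀ ℤ, ↑c.support ⊆ S ∧ x = c.sum (fun v n => (n : ℝ) • v) ∧ ∀ v, 0 ≤ c v := by
  classical
  induction hx using AddSubmonoid.closure_induction with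
  | mem x hx =>
    refine ⟨Finsupp.single x 1, ?_, by simp, fun v ↦ ?_⟩
    · exact (Finset.coe_subset.mpr Finsupp.support_single_subset).trans (by simpa using hx)
    · by_cases h : x = v <;> simp [h]
  | zero => exact ⟨0, by simp, by simp, by simp⟩
  | add x y _ _ hx hy =>
    obtain ⟨c, hcS, rfl, hc⟩ := hx
    obtain ⟨d, hdS, rfl, hd⟩ := hy
    refine ⟨c + d, ?_, ?_, fun v ↦ add_nonneg (hc v) (hd v)⟩
    · refine (Finset.coe_subset.mpr Finsupp.support_add).trans ?_
      simpa using ⟨hcS, hdS⟩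
    · rw [Finsupp.sum_add_index' (by simp) (by intros; push_cast; module)]

open IsAddIndecomposable in
/-- A linear functional that vanishes on no root is positive on some base. -/
theorem IsRootSystem.exists_isBase_pos {Δ : Set V} (hΔ : IsRootSystem Δ) (h : V →ₗ[ℝ] ℝ)
    (hne : ∀ α ∈ Δ, h α ≠ 0) : ∃ S, IsBase Δ S ∧ ∀ σ ∈ S, 0 < h σ := by
  obtain ⟨P, _, hP⟩ := hΔ.exists_rootPairing
  have : Finite Δ := hΔ.1
  let h' := h.domRestrict (Submodule.span ℝ Δ)
  have hh' (i : Δ) : h' (P.root i) = h i := by simp [h', hP]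
  have hne' (i : Δ) : h' (P.root i) ≠ 0 := by rw [hh']; exact hne i i.2
  let B := baseOf P.root (h' : Submodule.span ℝ Δ →+ ℝ)
  have hclosure {x : Submodule.span ℝ Δ} (hx : x ∈ AddSubmonoid.closure (P.root '' B)) :
      (x : V) ∈ AddSubmonoid.closure (((↑) : Δ → V) '' B) := by
    have := AddSubmonoid.mem_map_of_mem (Submodule.span ℝ Δ).subtype hx
    rw [AddMonoidHom.map_mclosure, Set.image_image] at this
    simpa [hP] using this
  refine ⟨(↑) '' B, ⟨?_, ?_, fun β hβ ↦ ?_⟩, ?_⟩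
  · rintro - ⟨i, -, rfl⟩
    exact i.2
  · have hli : LinearIndepOn ℝ P.root B := P.linearIndepOn_root_baseOf' h' hne'
    have hli' := hli.map_injOn (Submodule.span ℝ Δ).subtype Subtype.val_injective.injOn
    have : ⇑(Submodule.span ℝ Δ).subtype ∘ P.root = ((↑) : Δ → V) := funext hP
    rw [this] at hli'
    exact hli'.id_image
  · let := P.indexNeg
    rcases mem_or_neg_mem_closure_baseOf P.root (h' : Submodule.span ℝ Δ →+ ℝ) ⟨β, hβ⟩
      (hne' _) (by simp) with hmem | hmem
    · obtain ⟨c, hcS, hβc, hc⟩ := exists_finsupp_of_mem_closure (hclosure hmem)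
      exact ⟨c, hcS, by rw [← hβc, hP], .inl hc⟩
    · obtain ⟨c, hcS, hβc, hc⟩ := exists_finsupp_of_mem_closure (hclosure hmem)
      refine ⟨-c, by simpa using hcS, ?_, .inr fun v ↦ by simpa using hc v⟩
      rw [Finsupp.sum_neg_index (by simp)]
      simp only [Int.cast_neg, neg_smul, Finsupp.sum_neg, ← hβc]
      simp [hP]
  · rintro - ⟨i, hi, rfl⟩
    rw [← hh']
    exact hi.1

/-- A functional that vanishes on `U` and on no element of a finite set outside `U`. -/
theorem exists_linearMap_eq_zero_iff_mem {Δ : Set V} (hΔ : Δ.Finite) (U : Submodule ℝ V) :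
    ∃ f : V →ₗ[ℝ] ℝ, ∀ α ∈ Δ, f α = 0 ↔ α ∈ U := by
  have : Finite {α : V // α ∈ Δ ∧ α ∉ U} := hΔ.subset fun _ h ↦ h.1
  obtain ⟨f, hf⟩ := Module.exists_dual_forall_apply_ne_zero (K := ℝ)
    (fun α : {α : V // α ∈ Δ ∧ α ∉ U} ↦ U.mkQ α) fun α h ↦
      α.2.2 ((Submodule.Quotient.mk_eq_zero U).mp h)
  refine ⟨f ∘ₗ U.mkQ, fun α hα ↦ ⟨fun h ↦ ?_, fun h ↦ ?_⟩⟩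
  · by_contra hU
    exact hf ⟨α, hα, hU⟩ h
  · simp [(Submodule.Quotient.mk_eq_zero U).mpr h]

/-- On a finite set, a large multiple of `f` dominates `g` wherever `f` is nonzero. -/
theorem exists_smul_add_dominates {Δ : Set V} (hΔ : Δ.Finite) (f g : V →ₗ[ℝ] ℝ) :
    ∃ N : ℝ, ∀ α ∈ Δ,
      (f α < 0 → (N • f + g) α < 0) ∧ (0 < f α → 0 < (N • f + g) α) := by
  have key : ∀ᶠ N : ℝ in Filter.atTop, ∀ α ∈ Δ,
      (f α < 0 → (N • f + g) α < 0) ∧ (0 < f α → 0 < (N • f + g) α) := by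
    rw [Filter.eventually_all_finite hΔ]
    intro α _
    filter_upwards [Filter.eventually_gt_atTop (|g α| / |f α|)] with N hN
    have hbound (h : f α ≠ 0) : |g α| < N * |f α| := (div_lt_iff₀ (abs_pos.mpr h)).mp hN
    refine ⟨fun h ↦ ?_, fun h ↦ ?_⟩
    · have := hbound h.ne
      rw [abs_of_neg h] at this
      simp only [LinearMap.add_apply, LinearMap.smul_apply, smul_eq_mul]
      linarith [le_abs_self (g α)]
    · have := hbound h.ne'
      rw [abs_of_pos h] at this
      simp only [LinearMap.add_apply, LinearMap.smul_apply, smul_eq_mul]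
      linarith [neg_abs_le (g α)]
  exact key.exists

/-- A base on which `f` is nonnegative contains a basis of any subspace that is spanned by roots
and on which the roots are precisely the zeros of `f`. -/
theorem IsBase.span_inter_eq {Δ S I : Set V} (hS : IsBase Δ S) (hI : I ⊆ Δ)
    (f : V →ₗ[ℝ] ℝ) (hf : ∀ α ∈ Δ, f α = 0 ↔ α ∈ Submodule.span ℝ I)
    (hpos : ∀ σ ∈ S, 0 ≤ f σ) :
    Submodule.span ℝ (S ∩ Submodule.span ℝ I) = Submodule.span ℝ I := by
  refine le_antisymm (Submodule.span_le.mpr Set.inter_subset_right)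
    (Submodule.span_le.mpr fun β hβ ↦ ?_)
  have hfβ : f β = 0 := (hf β (hI hβ)).mpr (Submodule.subset_span hβ)
  obtain ⟨c, hcS, rfl, hc⟩ := hS.2.2 β (hI hβ)
  have hsum : ∑ v ∈ c.support, (c v : ℝ) * f v = 0 := by
    simpa [Finsupp.sum, map_sum] using hfβ
  have hzero : ∀ v ∈ c.support, (c v : ℝ) * f v = 0 := by
    rcases hc with hc | hc
    · exact (Finset.sum_eq_zero_iff_of_nonneg fun v hv ↦
        mul_nonneg (by exact_mod_cast hc v) (hpos v (hcS hv))).mp hsum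
    · exact (Finset.sum_eq_zero_iff_of_nonpos fun v hv ↦
        mul_nonpos_of_nonpos_of_nonneg (by exact_mod_cast hc v) (hpos v (hcS hv))).mp hsum
  refine Submodule.sum_mem _ fun v hv ↦ Submodule.smul_mem _ _ (Submodule.subset_span
    ⟨hcS hv, (hf v (hS.1 (hcS hv))).mp ?_⟩)
  exact (mul_eq_zero.mp (hzero v hv)).resolve_left
    (by exact_mod_cast Finsupp.mem_support_iff.mp hv)

/-- A nested pair of subspaces spanned by roots is spanned by a nested pair of subsets of a
single base. -/
theorem IsRootSystem.exists_isBase_adapted {Δ I₁ I₂ : Set V} (hΔ : IsRootSystem Δ)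
    (h₁ : I₁ ⊆ Δ) (h₂ : I₂ ⊆ Δ) (hle : Submodule.span ℝ I₁ ≤ Submodule.span ℝ I₂) :
    ∃ S, IsBase Δ S ∧
      Submodule.span ℝ (S ∩ Submodule.span ℝ I₁) = Submodule.span ℝ I₁ ∧
      Submodule.span ℝ (S ∩ Submodule.span ℝ I₂) = Submodule.span ℝ I₂ := by
  obtain ⟨f₀, hf₀⟩ := exists_linearMap_eq_zero_iff_mem hΔ.1 ⊥
  obtain ⟨f₁, hf₁⟩ := exists_linearMap_eq_zero_iff_mem hΔ.1 (Submodule.span ℝ I₁)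
  obtain ⟨f₂, hf₂⟩ := exists_linearMap_eq_zero_iff_mem hΔ.1 (Submodule.span ℝ I₂)
  obtain ⟨N, hN⟩ := exists_smul_add_dominates hΔ.1 f₂ f₁
  set g := N • f₂ + f₁ with hg
  obtain ⟨M, hM⟩ := exists_smul_add_dominates hΔ.1 g f₀
  have hg₁ : ∀ α ∈ Δ, g α = 0 ↔ α ∈ Submodule.span ℝ I₁ := by
    intro α hα
    rcases lt_trichotomy (f₂ α) 0 with h | h | h
    · exact iff_of_false ((hN α hα).1 h).ne fun hU ↦ h.ne ((hf₂ α hα).mpr (hle hU))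
    · rw [← hf₁ α hα]
      simp [hg, h]
    · exact iff_of_false ((hN α hα).2 h).ne' fun hU ↦ h.ne' ((hf₂ α hα).mpr (hle hU))
  obtain ⟨S, hS, hpos⟩ := hΔ.exists_isBase_pos (M • g + f₀) fun α hα h ↦ by
    rcases lt_trichotomy (g α) 0 with h' | h' | h'
    · exact ((hM α hα).1 h').ne h
    · have : f₀ α = 0 := by simpa [h'] using h
      exact hΔ.2.1 ((hf₀ α hα).mp this ▸ hα)
    · exact ((hM α hα).2 h').ne' h
  have hgS : ∀ σ ∈ S, 0 ≤ g σ := fun σ hσ ↦ not_lt.mp fun h ↦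
    (hpos σ hσ).not_gt ((hM σ (hS.1 hσ)).1 h)
  have hfS : ∀ σ ∈ S, 0 ≤ f₂ σ := fun σ hσ ↦ not_lt.mp fun h ↦
    (hgS σ hσ).not_gt ((hN σ (hS.1 hσ)).1 h)
  exact ⟨S, hS, hS.span_inter_eq h₁ g hg₁ hgS, hS.span_inter_eq h₂ f₂ hf₂ hfS⟩

/-- for subsets `I₁`, `I₂` of bases of a root system `Δ`, with quotient
projections `π₁`, `π₂`, there exists a surjection `π₁₂ : π₁(Δ) → π₂(Δ)` with
`π₂ = π₁₂ ∘ π₁` on `Δ` iff there are a base `Sg` of `Δ` and nested subsets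
`I₁' ⊆ I₂' ⊆ Sg` with the same spans as `I₁` and `I₂`. -/
theorem stmt8 (Δ I₁ I₂ : Set V) (hΔ : IsRootSystem Δ)
    (h₁ : ∃ Sg, IsBase Δ Sg ∧ I₁ ⊆ Sg) (h₂ : ∃ Sg, IsBase Δ Sg ∧ I₂ ⊆ Sg) :
    (∃ f : (V ⧸ Submodule.span ℝ I₁) → (V ⧸ Submodule.span ℝ I₂),
        (∀ α ∈ Δ, f ((Submodule.span ℝ I₁).mkQ α) = (Submodule.span ℝ I₂).mkQ α) ∧
        Set.SurjOn f ((Submodule.span ℝ I₁).mkQ '' Δ) ((Submodule.span ℝ I₂).mkQ '' Δ)) ↔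
    (∃ Sg, IsBase Δ Sg ∧ ∃ I₁' I₂' : Set V, I₁' ⊆ I₂' ∧ I₂' ⊆ Sg ∧
        Submodule.span ℝ I₁' = Submodule.span ℝ I₁ ∧
        Submodule.span ℝ I₂' = Submodule.span ℝ I₂) := by
  constructor
  · rintro ⟨f, hf, -⟩
    obtain ⟨S₁, hS₁, hI₁⟩ := h₁
    obtain ⟨S₂, hS₂, hI₂⟩ := h₂
    have hI₁Δ : I₁ ⊆ Δ := hI₁.trans hS₁.1
    have hle : Submodule.span ℝ I₁ ≤ Submodule.span ℝ I₂ := by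
      refine Submodule.span_le.mpr fun α hα ↦ ?_
      have hα0 : (Submodule.span ℝ I₁).mkQ α = 0 :=
        (Submodule.Quotient.mk_eq_zero _).mpr (Submodule.subset_span hα)
      have hpos := hf α (hI₁Δ hα)
      have hneg := hf (-α) (hΔ.2.2.1 α (hI₁Δ hα))
      rw [map_neg, map_neg, hα0, neg_zero] at hneg
      rw [hα0, hneg] at hpos
      have : IsAddTorsionFree (V ⧸ Submodule.span ℝ I₂) := .of_isTorsionFree ℝ _
      exact (Submodule.Quotient.mk_eq_zero _).mp (neg_eq_self.mp hpos)
    obtain ⟨S, hS, hspan₁, hspan₂⟩ :=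
      hΔ.exists_isBase_adapted hI₁Δ (hI₂.trans hS₂.1) hle
    exact ⟨S, hS, _, _, Set.inter_subset_inter_right S hle, Set.inter_subset_left, hspan₁, hspan₂⟩
  · rintro ⟨-, -, I₁', I₂', hsub, -, hspan₁, hspan₂⟩
    have hle : Submodule.span ℝ I₁ ≤ Submodule.span ℝ I₂ :=
      hspan₁ ▸ hspan₂ ▸ Submodule.span_mono hsub
    refine ⟨Submodule.factor hle, fun α _ ↦ rfl, ?_⟩
    rintro - ⟨α, hα, rfl⟩
    exact ⟨_, ⟨α, hα, rfl⟩, rfl⟩
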